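/- Let 𝕀 be a two-sided ad_T-invariant ideal of T(𝔞) containing ker τ[t], let V = T(𝔞)/𝕀 with the 𝔞-module structure ρ_𝕀 induced by ad_T, and define η_𝕀 : 𝔞 → End(V) by η_𝕀(x)(𝐲 + 𝕀) = x⊗𝐲 + 𝕀. Then η_𝕀 ∈ ℋ_{ρ_𝕀}(T(𝔞)/𝕀), and the kernel of the algebra homomorphism (η_𝕀)_T : T(𝔞) → End(V) extending η_𝕀 equals 𝕀. -/

import Mathlib

open TensorAlgebra TensorProduct Polynomial

noncomputable section

/-- The graded pieces `F^r(a)` of the free Lie algebra on the vector space `a`,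
realized inside the tensor algebra `T(a)`:  `F¹(a) = ι(a)` and `F^{r+1}(a)` is spanned by
the commutators `ι(x) * y - y * ι(x)` with `x ∈ a`, `y ∈ F^r(a)`. -/
def Fr (a : Type*) [LieRing a] [LieAlgebra ℂ a] : ℕ → Submodule ℂ (TensorAlgebra ℂ a)
  | 0 => ⊥
  | 1 => LinearMap.range (TensorAlgebra.ι ℂ (M := a))
  | (r + 2) => Submodule.span ℂ
      {u | ∃ (x : a) (y : TensorAlgebra ℂ a), y ∈ Fr a (r + 1) ∧
        u = TensorAlgebra.ι ℂ x * y - y * TensorAlgebra.ι ℂ x}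

/-- The free Lie algebra `F(a) = ⊕_{r>0} F^r(a)` on the vector space `a`,
as a subspace of the tensor algebra. -/
def FLie (a : Type*) [LieRing a] [LieAlgebra ℂ a] : Submodule ℂ (TensorAlgebra ℂ a) :=
  ⨆ r, Fr a r

/-- `IsTau a τ` says that the linear map `τ` is (a linear extension to `T(a)` of) the canonical
Lie algebra homomorphism `τ : F(a) → a`: it is the identity on `F¹(a) = a` and takes the
commutator bracket of `T(a)` (restricted to `F(a)`) to the bracket of `a`. -/
def IsTau (a : Type*) [LieRing a] [LieAlgebra ℂ a] (τ : TensorAlgebra ℂ a →ₗ[ℂ] a) : Prop :=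
  (∀ x : a, τ (TensorAlgebra.ι ℂ x) = x) ∧
  ∀ r s : ℕ, ∀ u ∈ Fr a r, ∀ v ∈ Fr a s, τ (u * v - v * u) = ⁅τ u, τ v⁆

/-- The current algebra `a[t] = a ⊗ ℂ[t]`, with bracket `⁅x ⊗ f, y ⊗ g⁆ = ⁅x, y⁆ ⊗ fg`. -/
abbrev Cur (a : Type*) [LieRing a] [LieAlgebra ℂ a] : Type _ := Polynomial ℂ ⊗[ℂ] a

/-- `IsTauT a τ τt` says that the linear map `τt` is (a linear extension to `T(a)` of) the map
`τ[t] : F(a) → a[t]` given by `τ[t](𝐱) = τ(𝐱) ⊗ t^r` for `𝐱 ∈ F^r(a)`. -/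
def IsTauT (a : Type*) [LieRing a] [LieAlgebra ℂ a] (τ : TensorAlgebra ℂ a →ₗ[ℂ] a)
    (τt : TensorAlgebra ℂ a →ₗ[ℂ] Cur a) : Prop :=
  ∀ r : ℕ, ∀ u ∈ Fr a r, τt u = ((X : ℂ[X]) ^ r) ⊗ₜ[ℂ] (τ u)

end

noncomputable section

/-- `IsAdT a adT` says that `adT` is the diagonal adjoint action of `a` on its tensor algebra,
i.e. `adT x` is the derivation of `T(a)` with `adT x (ι y) = ι ⁅x, y⁆`. -/
def IsAdT (a : Type*) [LieRing a] [LieAlgebra ℂ a]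
    (adT : a →ₗ[ℂ] Module.End ℂ (TensorAlgebra ℂ a)) : Prop :=
  (∀ x : a, adT x 1 = 0) ∧
  (∀ x y : a, adT x (TensorAlgebra.ι ℂ y) = TensorAlgebra.ι ℂ ⁅x, y⁆) ∧
  (∀ (x : a) (u v : TensorAlgebra ℂ a), adT x (u * v) = adT x u * v + u * adT x v)

/-- The bracket of the semidirect product `𝔉 = a ⊕ F(a)`, written on the ambient space
`a × T(a)`:  `⁅(x, 𝐲), (x', 𝐲')⁆ = (⁅x,x'⁆, adT x 𝐲' - adT x' 𝐲 + (𝐲𝐲' - 𝐲'𝐲))`. -/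
def Fbr (a : Type*) [LieRing a] [LieAlgebra ℂ a]
    (adT : a →ₗ[ℂ] Module.End ℂ (TensorAlgebra ℂ a))
    (p q : a × TensorAlgebra ℂ a) : a × TensorAlgebra ℂ a :=
  (⁅p.1, q.1⁆, adT p.1 q.2 - adT q.1 p.2 + (p.2 * q.2 - q.2 * p.2))

/-- The extension of `τ[t]` to `𝔉 = a ⊕ F(a)`, sending `(x, 𝐲)` to `x ⊗ 1 + τ[t](𝐲)`. -/
def PhiF (a : Type*) [LieRing a] [LieAlgebra ℂ a]
    (τt : TensorAlgebra ℂ a →ₗ[ℂ] Cur a) (p : a × TensorAlgebra ℂ a) : Cur a :=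
  (1 : ℂ[X]) ⊗ₜ[ℂ] p.1 + τt p.2

end

noncomputable section

/-- `MemH a V τ ρ η`, i.e. `(ρ, η) ∈ ℋ(V)`:  `ρ` is a Lie algebra homomorphism (C1), `η` is a
homomorphism of `a`-modules for the `a`-module structure on `End V` induced by `ρ` (C2), and
`ker τ_r ⊆ ker η^{⊙r}` for all `r > 0` (C3), where `η^{⊙r}` is the restriction to
`F^r(a) ⊆ T^r(a)` of the algebra homomorphism `η_T : T(a) → End V` extending `η`. -/
def MemH (a : Type*) [LieRing a] [LieAlgebra ℂ a] {V : Type*} [AddCommGroup V] [Module ℂ V]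
    (τ : TensorAlgebra ℂ a →ₗ[ℂ] a) (ρ η : a →ₗ[ℂ] Module.End ℂ V) : Prop :=
  (∀ x y : a, ρ ⁅x, y⁆ = ⁅ρ x, ρ y⁆) ∧
  (∀ x y : a, η ⁅x, y⁆ = ⁅ρ x, η y⁆) ∧
  (∀ r : ℕ, ∀ u ∈ Fr a r, τ u = 0 → TensorAlgebra.lift ℂ η u = 0)

/-- `IsCurHom a ρ₁ η₁ ρ₂ η₂ φ` says that the linear map `φ : V₁ → V₂` is a homomorphism of
`a[t]`-modules from `V₁(ρ₁, η₁)` to `V₂(ρ₂, η₂)`: it intertwines the actions of `x ⊗ 1`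
(given by `ρᵢ`) and of `x ⊗ t^r` (given by `ηᵢ^{⊙r}(𝐱)` for `𝐱 ∈ F^r(a)` with `τ_r(𝐱) = x`). -/
def IsCurHom (a : Type*) [LieRing a] [LieAlgebra ℂ a]
    {V1 V2 : Type*} [AddCommGroup V1] [Module ℂ V1] [AddCommGroup V2] [Module ℂ V2]
    (ρ1 η1 : a →ₗ[ℂ] Module.End ℂ V1) (ρ2 η2 : a →ₗ[ℂ] Module.End ℂ V2)
    (φ : V1 →ₗ[ℂ] V2) : Prop :=
  (∀ x : a, φ ∘ₗ ρ1 x = ρ2 x ∘ₗ φ) ∧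
  ∀ r : ℕ, ∀ u ∈ Fr a r,
    φ ∘ₗ (TensorAlgebra.lift ℂ η1 u : Module.End ℂ V1)
      = (TensorAlgebra.lift ℂ η2 u : Module.End ℂ V2) ∘ₗ φ

end

/-- The diagonal adjoint action on the tensor algebra is a Lie algebra action. -/
theorem IsAdT.map_lie_apply {a : Type*} [LieRing a] [LieAlgebra ℂ a]
    {adT : a →ₗ[ℂ] Module.End ℂ (TensorAlgebra ℂ a)} (hadT : IsAdT a adT)
    (x y : a) (u : TensorAlgebra ℂ a) :
    adT ⁅x, y⁆ u = adT x (adT y u) - adT y (adT x u) := by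
  obtain ⟨map_one, map_ι, leibniz⟩ := hadT
  induction u using TensorAlgebra.induction with
  | algebraMap c => simp [Algebra.algebraMap_eq_smul_one, map_one]
  | ι z => rw [map_ι, map_ι, map_ι, map_ι, map_ι, lie_lie, map_sub]
  | mul u v hu hv =>
    simp only [leibniz, hu, hv, map_add]
    noncomm_ring
  | add u v hu hv =>
    simp only [map_add, hu, hv]
    abel

/-- If `η x` is induced on a quotient of the tensor algebra by left multiplication by `x`, then
the algebra homomorphism extending `η` is induced by left multiplication. -/
theorem TensorAlgebra.lift_apply_quotient_mk {R M : Type*} [CommRing R] [AddCommGroup M]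
    [Module R M] {I : Submodule R (TensorAlgebra R M)}
    {η : M →ₗ[R] Module.End R (TensorAlgebra R M ⧸ I)}
    (hη : ∀ (x : M) (u : TensorAlgebra R M),
      η x (Submodule.Quotient.mk u) = Submodule.Quotient.mk (TensorAlgebra.ι R x * u))
    (w u : TensorAlgebra R M) :
    TensorAlgebra.lift R η w (Submodule.Quotient.mk u) = Submodule.Quotient.mk (w * u) := by
  induction w using TensorAlgebra.induction generalizing u with
  | algebraMap c => simp [Module.algebraMap_end_apply, ← Algebra.smul_def]
  | ι x => rw [TensorAlgebra.lift_ι_apply, hη]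
  | mul v w hv hw => rw [map_mul, Module.End.mul_apply, hw, hv, mul_assoc]
  | add v w hv hw =>
    rw [map_add, LinearMap.add_apply, hv, hw, add_mul, Submodule.Quotient.mk_add]

/-- If `η x` is induced by left multiplication by `x` on the quotient of the tensor algebra by a
right ideal `I`, then the kernel of the algebra homomorphism extending `η` is `I`. -/
theorem TensorAlgebra.lift_eq_zero_iff_mem {R M : Type*} [CommRing R] [AddCommGroup M]
    [Module R M] {I : Submodule R (TensorAlgebra R M)}
    (hI : ∀ (w : TensorAlgebra R M), ∀ u ∈ I, u * w ∈ I)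
    {η : M →ₗ[R] Module.End R (TensorAlgebra R M ⧸ I)}
    (hη : ∀ (x : M) (u : TensorAlgebra R M),
      η x (Submodule.Quotient.mk u) = Submodule.Quotient.mk (TensorAlgebra.ι R x * u))
    (w : TensorAlgebra R M) :
    TensorAlgebra.lift R η w = 0 ↔ w ∈ I := by
  constructor
  · intro h
    have h1 := lift_apply_quotient_mk hη w 1
    rw [h, LinearMap.zero_apply, mul_one] at h1
    exact (Submodule.Quotient.mk_eq_zero I).1 h1.symm
  · intro h
    refine LinearMap.ext fun v => ?_
    obtain ⟨u, rfl⟩ := Submodule.Quotient.mk_surjective I v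
    rw [lift_apply_quotient_mk hη, LinearMap.zero_apply, Submodule.Quotient.mk_eq_zero]
    exact hI u w h

/-- Let `𝕀` be a two-sided `ad_T`-invariant ideal of `T(a)` containing
`ker τ[t]`, let `V = T(a)/𝕀` with the `a`-module structure `ρ_𝕀` induced by `ad_T`, and let
`η_𝕀(x)(𝐲 + 𝕀) = x ⊗ 𝐲 + 𝕀`.  Then `η_𝕀 ∈ ℋ_{ρ_𝕀}(T(a)/𝕀)`, and the kernel of the algebra
homomorphism `(η_𝕀)_T : T(a) → End (T(a)/𝕀)` extending `η_𝕀` equals `𝕀`. -/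
theorem statement8 (a : Type*) [LieRing a] [LieAlgebra ℂ a]
    (h𝔞 : Submodule.span ℂ {z : a | ∃ x y : a, z = ⁅x, y⁆} = ⊤)
    (τ : TensorAlgebra ℂ a →ₗ[ℂ] a) (hτ : IsTau a τ)
    (τt : TensorAlgebra ℂ a →ₗ[ℂ] Cur a) (hτt : IsTauT a τ τt)
    (adT : a →ₗ[ℂ] Module.End ℂ (TensorAlgebra ℂ a)) (hadT : IsAdT a adT)
    (I : Submodule ℂ (TensorAlgebra ℂ a))
    (hIl : ∀ (w : TensorAlgebra ℂ a), ∀ u ∈ I, w * u ∈ I)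
    (hIr : ∀ (w : TensorAlgebra ℂ a), ∀ u ∈ I, u * w ∈ I)
    (hIad : ∀ (x : a), ∀ u ∈ I, adT x u ∈ I)
    (hIker : ∀ u ∈ FLie a, τt u = 0 → u ∈ I)
    (ρI ηI : a →ₗ[ℂ] Module.End ℂ (TensorAlgebra ℂ a ⧸ I))
    (hρI : ∀ (x : a) (u : TensorAlgebra ℂ a),
      ρI x (Submodule.Quotient.mk u) = Submodule.Quotient.mk (adT x u))
    (hηI : ∀ (x : a) (u : TensorAlgebra ℂ a),
      ηI x (Submodule.Quotient.mk u) = Submodule.Quotient.mk (TensorAlgebra.ι ℂ x * u)) :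
    MemH a τ ρI ηI ∧
    ∀ w : TensorAlgebra ℂ a,
      (TensorAlgebra.lift ℂ ηI w : Module.End ℂ (TensorAlgebra ℂ a ⧸ I)) = 0 ↔ w ∈ I := by
  have hker := TensorAlgebra.lift_eq_zero_iff_mem hIr hηI
  refine ⟨⟨fun x y => ?_, fun x y => ?_, fun r u hu h => ?_⟩, hker⟩
  · refine LinearMap.ext fun v => ?_
    obtain ⟨u, rfl⟩ := Submodule.Quotient.mk_surjective I v
    rw [Ring.lie_def, LinearMap.sub_apply, Module.End.mul_apply, Module.End.mul_apply, hρI, hρI, hρI, hρI, hρI,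
      hadT.map_lie_apply, Submodule.Quotient.mk_sub]
  · refine LinearMap.ext fun v => ?_
    obtain ⟨u, rfl⟩ := Submodule.Quotient.mk_surjective I v
    rw [Ring.lie_def, LinearMap.sub_apply, Module.End.mul_apply, Module.End.mul_apply, hηI, hηI, hρI, hρI, hηI,
      ← Submodule.Quotient.mk_sub, hadT.2.2, hadT.2.1, add_sub_cancel_right]
  · refine (hker u).2 (hIker u (Submodule.mem_iSup_of_mem r hu) ?_)
    rw [hτt r u hu, h, TensorProduct.tmul_zero]
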